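/- arXiv:2511.12023 — 2 statements merged into one kernel-verified Lean document; each statement's English description precedes it below -/
import Mathlib

section
/- For all $0 \le a \le t$ one has $\int_a^t \left(\int_\theta^t K_H(t,s)^2\,ds\right)\left(\int_\theta^t K_H(s,\theta)^2\,ds\right) d\theta \; \le \; (t-a)^{4H+1}$. -/
open MeasureTheory Set

/-- The Euler Beta function `B(x,y) = Γ(x)Γ(y)/Γ(x+y)`. -/
noncomputable def eulerBeta (x y : ℝ) : ℝ := Real.Gamma x * Real.Gamma y / Real.Gamma (x + y)

/-- The normalizing constant `c_H = √(H(2H-1)/B(2-2H, H-1/2))`. -/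
noncomputable def cH (H : ℝ) : ℝ :=
  Real.sqrt (H * (2*H - 1) / eulerBeta (2 - 2*H) (H - 1/2))

/-- The fractional Brownian motion kernel:
`K_H(t,s) = c_H s^(1/2-H) ∫_s^t (u-s)^(H-3/2) u^(H-1/2) du` for `0 < s < t`, and `0` otherwise. -/
noncomputable def KH (H : ℝ) (t s : ℝ) : ℝ :=
  if 0 < s ∧ s < t then
    cH H * s ^ ((1:ℝ)/2 - H) * ∫ u in s..t, (u - s) ^ (H - 3/2) * u ^ (H - 1/2)
  else 0

open scoped ENNReal

lemma lintegral_rpow_mul_one_sub_rpow {x y : ℝ} (hx : 0 < x) (hy : 0 < y) :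
    ∫⁻ z in Ioo (0 : ℝ) 1, ENNReal.ofReal (z ^ (x - 1) * (1 - z) ^ (y - 1))
      = ENNReal.ofReal (eulerBeta x y) := by
  have hpos : 0 < ProbabilityTheory.beta x y := ProbabilityTheory.beta_pos hx hy
  have h := ProbabilityTheory.lintegral_betaPDF_eq_one hx hy
  rw [ProbabilityTheory.lintegral_betaPDF] at h
  simp_rw [mul_assoc, ENNReal.ofReal_mul (one_div_pos.2 hpos).le] at h
  rw [lintegral_const_mul' _ _ ENNReal.ofReal_ne_top] at h
  change _ = ENNReal.ofReal (ProbabilityTheory.beta x y)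
  rw [← mul_one (ENNReal.ofReal (ProbabilityTheory.beta x y)), ← h, ← mul_assoc,
    ← ENNReal.ofReal_mul hpos.le, mul_one_div_cancel hpos.ne', ENNReal.ofReal_one, one_mul]

lemma lintegral_sub_left_rpow {c d r : ℝ} (hr : -1 < r) (hcd : c ≤ d) :
    ∫⁻ v in Ioc c d, ENNReal.ofReal ((v - c) ^ r)
      = ENNReal.ofReal ((d - c) ^ (r + 1) / (r + 1)) := by
  have hint : IntervalIntegrable (fun v : ℝ ↦ (v - c) ^ r) volume c d := by
    have := (intervalIntegral.intervalIntegrable_rpow' (a := 0) (b := d - c) hr).comp_sub_right c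
    simpa using this
  rw [← ofReal_integral_eq_lintegral_ofReal
    ((intervalIntegrable_iff_integrableOn_Ioc_of_le hcd).1 hint)
    ((ae_restrict_iff' measurableSet_Ioc).2
      (.of_forall fun v hv ↦ Real.rpow_nonneg (by linarith [hv.1]) _)),
    ← intervalIntegral.integral_of_le hcd,
    intervalIntegral.integral_comp_sub_right (fun v : ℝ ↦ v ^ r), integral_rpow (.inl hr),
    sub_self, Real.zero_rpow (by linarith), sub_zero]

lemma lintegral_sub_right_rpow {c d r : ℝ} (hr : -1 < r) (hcd : c ≤ d) :
    ∫⁻ v in Ioc c d, ENNReal.ofReal ((d - v) ^ r)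
      = ENNReal.ofReal ((d - c) ^ (r + 1) / (r + 1)) := by
  have hint : IntervalIntegrable (fun v : ℝ ↦ (d - v) ^ r) volume c d := by
    have := (intervalIntegral.intervalIntegrable_rpow' (a := d - c) (b := 0) hr).comp_sub_left d
    simpa using this
  rw [← ofReal_integral_eq_lintegral_ofReal
    ((intervalIntegrable_iff_integrableOn_Ioc_of_le hcd).1 hint)
    ((ae_restrict_iff' measurableSet_Ioc).2
      (.of_forall fun v hv ↦ Real.rpow_nonneg (by linarith [hv.2]) _)),
    ← intervalIntegral.integral_of_le hcd,
    intervalIntegral.integral_comp_sub_left (fun v : ℝ ↦ v ^ r), integral_rpow (.inl hr),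
    sub_self, Real.zero_rpow (by linarith), sub_zero]

lemma lintegral_lintegral_abs_sub_rpow_le {H a t : ℝ} (hH : H ∈ Ioo (1 / 2 : ℝ) 1)
    (hat : a ≤ t) :
    ∫⁻ u in Ioc a t, ∫⁻ v in Ioc a t, ENNReal.ofReal (H * (2 * H - 1) * |u - v| ^ (2 * H - 2))
      ≤ ENNReal.ofReal ((t - a) ^ (2 * H)) := by
  obtain ⟨hH1, hH2⟩ := hH
  have hc : 0 < H * (2 * H - 1) := by nlinarith
  have inner : ∀ u ∈ Ioc a t,
      ∫⁻ v in Ioc a t, ENNReal.ofReal (H * (2 * H - 1) * |u - v| ^ (2 * H - 2))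
        ≤ ENNReal.ofReal H * (ENNReal.ofReal ((u - a) ^ (2 * H - 1))
          + ENNReal.ofReal ((t - u) ^ (2 * H - 1))) := by
    intro u hu
    simp_rw [ENNReal.ofReal_mul hc.le]
    rw [lintegral_const_mul' _ _ ENNReal.ofReal_ne_top]
    have hleft : ∫⁻ v in Ioc a u, ENNReal.ofReal (|u - v| ^ (2 * H - 2))
        = ENNReal.ofReal ((u - a) ^ (2 * H - 1) / (2 * H - 1)) := by
      rw [setLIntegral_congr_fun (g := fun v ↦ ENNReal.ofReal ((u - v) ^ (2 * H - 2)))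
        measurableSet_Ioc fun v hv ↦ by simp only [abs_of_nonneg (sub_nonneg.2 hv.2)],
        lintegral_sub_right_rpow (by linarith) hu.1.le]
      ring_nf
    have hright : ∫⁻ v in Ioc u t, ENNReal.ofReal (|u - v| ^ (2 * H - 2))
        = ENNReal.ofReal ((t - u) ^ (2 * H - 1) / (2 * H - 1)) := by
      rw [setLIntegral_congr_fun (g := fun v ↦ ENNReal.ofReal ((v - u) ^ (2 * H - 2)))
        measurableSet_Ioc fun v hv ↦ by
          simp only [abs_sub_comm u, abs_of_nonneg (sub_nonneg.2 hv.1.le)],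
        lintegral_sub_left_rpow (by linarith) hu.2]
      ring_nf
    rw [← Ioc_union_Ioc_eq_Ioc hu.1.le hu.2]
    refine (mul_le_mul_right (lintegral_union_le _ _ _) _).trans_eq ?_
    have h1 : 0 ≤ (u - a) ^ (2 * H - 1) := Real.rpow_nonneg (by linarith [hu.1]) _
    have h2 : 0 ≤ (t - u) ^ (2 * H - 1) := Real.rpow_nonneg (by linarith [hu.2]) _
    have h3 : 0 < 2 * H - 1 := by linarith
    rw [hleft, hright, ← ENNReal.ofReal_add (by positivity) (by positivity),
      ← ENNReal.ofReal_mul hc.le, ← ENNReal.ofReal_add h1 h2, ← ENNReal.ofReal_mul (by linarith),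
      ← add_div, mul_assoc, mul_div_cancel₀ _ h3.ne']
  refine (setLIntegral_mono (by fun_prop) inner).trans_eq ?_
  rw [lintegral_const_mul' _ _ ENNReal.ofReal_ne_top, lintegral_add_left (by fun_prop),
    lintegral_sub_left_rpow (by linarith) hat, lintegral_sub_right_rpow (by linarith) hat]
  have h1 : 0 ≤ (t - a) ^ (2 * H - 1 + 1) := Real.rpow_nonneg (by linarith) _
  have h3 : 0 < 2 * H - 1 + 1 := by linarith
  rw [← ENNReal.ofReal_add (by positivity) (by positivity), ← ENNReal.ofReal_mul (by linarith)]
  congr 1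
  rw [show 2 * H - 1 + 1 = 2 * H by ring]
  field_simp
  ring

lemma lintegral_rpow_mul_sub_rpow_mul_sub_rpow {H u v : ℝ} (hH : H ∈ Ioo (1 / 2 : ℝ) 1)
    (hu : 0 < u) (huv : u < v) :
    ∫⁻ s in Ioo 0 u,
        ENNReal.ofReal (s ^ (1 - 2 * H) * (u - s) ^ (H - 3 / 2) * (v - s) ^ (H - 3 / 2))
      = ENNReal.ofReal ((u * v) ^ (1 / 2 - H) * (v - u) ^ (2 * H - 2)
          * eulerBeta (2 - 2 * H) (H - 1 / 2)) := by
  obtain ⟨hH1, hH2⟩ := hH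
  have hv : 0 < v := hu.trans huv
  have hd : 0 < v - u := sub_pos.2 huv
  have hden : ∀ x ∈ Ioo (0 : ℝ) 1, 0 < v - u * x := fun x hx ↦ by nlinarith [hx.2]
  set f : ℝ → ℝ := fun x ↦ u * v * (1 - x) / (v - u * x) with hf
  set f' : ℝ → ℝ := fun x ↦ -(u * v * (v - u) / (v - u * x) ^ 2) with hf'
  have hu_sub : ∀ x ∈ Ioo (0 : ℝ) 1, u - f x = u * x * (v - u) / (v - u * x) := fun x hx ↦ by
    have := (hden x hx).ne'
    simp only [hf]; field_simp; ring
  have hv_sub : ∀ x ∈ Ioo (0 : ℝ) 1, v - f x = v * (v - u) / (v - u * x) := fun x hx ↦ by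
    have := (hden x hx).ne'
    simp only [hf]; field_simp; ring
  have hderiv : ∀ x ∈ Ioo (0 : ℝ) 1, HasDerivWithinAt f (f' x) (Ioo 0 1) x := fun x hx ↦ by
    have h0 := (hden x hx).ne'
    have h1 : HasDerivAt (fun x : ℝ ↦ u * v * (1 - x)) (u * v * (-1)) x :=
      ((hasDerivAt_id x).const_sub 1).const_mul _
    have h2 : HasDerivAt (fun x : ℝ ↦ v - u * x) (-(u * 1)) x :=
      ((hasDerivAt_id x).const_mul u).const_sub v
    refine (h1.div h2 h0).hasDerivWithinAt.congr_deriv ?_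
    simp only [hf']; field_simp; ring
  have hinj : InjOn f (Ioo 0 1) := fun x hx y hy hxy ↦ by
    have h1 := (hden x hx).ne'
    have h2 := (hden y hy).ne'
    have h3 := hv_sub x hx
    rw [hxy, hv_sub y hy, div_eq_div_iff h2 h1] at h3
    have h4 := mul_left_cancel₀ (mul_pos hv hd).ne' h3
    have h5 : u * x = u * y := by linarith
    exact mul_left_cancel₀ hu.ne' h5
  have himage : f '' Ioo 0 1 = Ioo 0 u := by
    ext s
    constructor
    · rintro ⟨x, hx, rfl⟩
      have h0 := hden x hx
      have h1 := hu_sub x hx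
      have hx1 : 0 < 1 - x := sub_pos.2 hx.2
      have hx0 := hx.1
      have h2 : 0 < u * x * (v - u) / (v - u * x) := by positivity
      exact ⟨by simp only [hf]; positivity, by linarith⟩
    · rintro ⟨hs0, hsu⟩
      have hvs : 0 < v - s := by linarith
      have hus : 0 < u - s := by linarith
      refine ⟨v * (u - s) / (u * (v - s)), ⟨by positivity, ?_⟩, ?_⟩
      · rw [div_lt_one (by positivity)]; nlinarith
      · have h1 : v - u * (v * (u - s) / (u * (v - s))) = v * (v - u) / (v - s) := by
          field_simp; ring
        simp only [hf]
        rw [h1]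
        field_simp; ring
  rw [← himage, lintegral_image_eq_lintegral_abs_deriv_mul measurableSet_Ioo hderiv hinj]
  have hC : 0 ≤ (u * v) ^ (1 / 2 - H) * (v - u) ^ (2 * H - 2) := by positivity
  rw [ENNReal.ofReal_mul hC, show eulerBeta (2 - 2 * H) (H - 1 / 2)
      = eulerBeta (H - 1 / 2) (2 - 2 * H) by simp only [eulerBeta]; rw [mul_comm, add_comm],
    ← lintegral_rpow_mul_one_sub_rpow (by linarith) (by linarith),
    ← lintegral_const_mul' _ _ ENNReal.ofReal_ne_top]
  refine setLIntegral_congr_fun measurableSet_Ioo fun x hx ↦ ?_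
  have h0 := hden x hx
  have hx0 := hx.1
  have hx1 : 0 < 1 - x := sub_pos.2 hx.2
  rw [← ENNReal.ofReal_mul (abs_nonneg _), ← ENNReal.ofReal_mul hC]
  congr 1
  rw [hu_sub x hx, hv_sub x hx]
  simp only [hf, hf', abs_neg]
  rw [abs_of_pos (by positivity)]
  refine Real.log_injOn_pos (mem_Ioi.2 (by positivity)) (mem_Ioi.2 (by positivity)) ?_
  have e1 := h0.ne'
  have e2 := hx1.ne'
  have e3 := hd.ne'
  simp (disch := positivity) only [Real.log_mul, Real.log_div, Real.log_rpow, Real.log_pow]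
  push_cast
  ring

/-- The density `∂K_H(u,s)/∂u` of the fractional Brownian motion kernel, extended by `0`. -/
noncomputable def kernelDensity (H u s : ℝ) : ℝ≥0∞ :=
  if 0 < s ∧ s < u then
    ENNReal.ofReal (cH H * s ^ ((1 : ℝ) / 2 - H) * ((u - s) ^ (H - 3 / 2) * u ^ (H - 1 / 2)))
  else 0

/-- The fractional Brownian motion kernel as an extended nonnegative function. -/
noncomputable def lkernel (H t s : ℝ) : ℝ≥0∞ := ∫⁻ u in Iic t, kernelDensity H u s

lemma measurable_kernelDensity (H : ℝ) :
    Measurable fun p : ℝ × ℝ ↦ kernelDensity H p.1 p.2 := by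
  unfold kernelDensity
  refine Measurable.ite ?_ (by fun_prop) measurable_const
  exact (measurableSet_lt measurable_const measurable_snd).inter
    (measurableSet_lt measurable_snd measurable_fst)

lemma Measurable.kernelDensity {α : Type*} [MeasurableSpace α] {f g : α → ℝ} (H : ℝ)
    (hf : Measurable f) (hg : Measurable g) :
    Measurable fun x ↦ kernelDensity H (f x) (g x) :=
  (measurable_kernelDensity H).comp (hf.prodMk hg)

lemma measurable_lkernel (H : ℝ) : Measurable fun p : ℝ × ℝ ↦ lkernel H p.1 p.2 := by
  simp only [lkernel, ← lintegral_indicator measurableSet_Iic]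
  refine Measurable.lintegral_prod_right'
    (f := fun q : (ℝ × ℝ) × ℝ ↦ (Iic q.1.1).indicator (fun u ↦ kernelDensity H u q.1.2) q.2) ?_
  simp only [indicator_apply]
  refine Measurable.ite ?_
    (.kernelDensity H measurable_snd (measurable_snd.comp measurable_fst)) measurable_const
  exact measurableSet_le measurable_snd (measurable_fst.comp measurable_fst)

lemma enorm_KH_le_lkernel (H t s : ℝ) : ‖KH H t s‖ₑ ≤ lkernel H t s := by
  unfold KH
  split_ifs with h
  · obtain ⟨hs, hst⟩ := h
    rw [← intervalIntegral.integral_const_mul, intervalIntegral.integral_of_le hst.le]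
    refine (enorm_integral_le_lintegral_enorm _).trans ?_
    refine le_trans ?_ (lintegral_mono_set (Ioc_subset_Iic_self : Ioc s t ⊆ Iic t))
    refine setLIntegral_mono' measurableSet_Ioc fun u hu ↦ ?_
    have h1 : 0 < u - s := sub_pos.2 hu.1
    have h2 : 0 < u := hs.trans hu.1
    have h3 : 0 ≤ cH H := Real.sqrt_nonneg _
    rw [Real.enorm_of_nonneg (by positivity), kernelDensity, if_pos ⟨hs, hu.1⟩]
  · simp

lemma lintegral_kernelDensity_mul_kernelDensity_of_lt {H u v : ℝ} (hH : H ∈ Ioo (1 / 2 : ℝ) 1)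
    (hu : 0 < u) (huv : u < v) :
    ∫⁻ s in Ioi 0, kernelDensity H u s * kernelDensity H v s
      = ENNReal.ofReal (H * (2 * H - 1) * (v - u) ^ (2 * H - 2)) := by
  have hv : 0 < v := hu.trans huv
  have hd : 0 < v - u := sub_pos.2 huv
  have hB : 0 < eulerBeta (2 - 2 * H) (H - 1 / 2) :=
    ProbabilityTheory.beta_pos (by linarith [hH.2]) (by linarith [hH.1])
  have hc : 0 < H * (2 * H - 1) := by nlinarith [hH.1]
  have hC : 0 ≤ cH H ^ 2 * (u * v) ^ (H - 1 / 2) := by positivity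
  have hzero : ∫⁻ s in Ici u, kernelDensity H u s * kernelDensity H v s = 0 :=
    setLIntegral_eq_zero measurableSet_Ici fun s hs ↦ by
      simp [kernelDensity, not_lt.2 (mem_Ici.1 hs)]
  have hdisj : Disjoint (Ioo 0 u) (Ici u) :=
    disjoint_left.2 fun s hs hs' ↦ not_lt.2 (mem_Ici.1 hs') hs.2
  rw [← Ioo_union_Ici_eq_Ioi hu, lintegral_union measurableSet_Ici hdisj, hzero, add_zero,
    setLIntegral_congr_fun (g := fun s ↦ ENNReal.ofReal (cH H ^ 2 * (u * v) ^ (H - 1 / 2))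
      * ENNReal.ofReal (s ^ (1 - 2 * H) * (u - s) ^ (H - 3 / 2) * (v - s) ^ (H - 3 / 2)))
      measurableSet_Ioo ?_,
    lintegral_const_mul' _ _ ENNReal.ofReal_ne_top,
    lintegral_rpow_mul_sub_rpow_mul_sub_rpow hH hu huv, ← ENNReal.ofReal_mul hC]
  · congr 1
    have hp : (u * v) ^ (H - 1 / 2) * (u * v) ^ (1 / 2 - H) = 1 := by
      rw [← Real.rpow_add (by positivity)]; simp
    rw [cH, Real.sq_sqrt (by positivity)]
    calc _ = H * (2 * H - 1) / eulerBeta (2 - 2 * H) (H - 1 / 2)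
            * eulerBeta (2 - 2 * H) (H - 1 / 2)
            * ((u * v) ^ (H - 1 / 2) * (u * v) ^ (1 / 2 - H)) * (v - u) ^ (2 * H - 2) := by ring
      _ = _ := by rw [hp, div_mul_cancel₀ _ hB.ne', mul_one]
  · rintro s ⟨hs, hsu⟩
    have h1 : 0 < u - s := sub_pos.2 hsu
    have h2 : 0 < v - s := by linarith
    have h3 : 0 ≤ cH H := Real.sqrt_nonneg _
    simp only [kernelDensity]
    rw [if_pos ⟨hs, hsu⟩, if_pos ⟨hs, hsu.trans huv⟩, ← ENNReal.ofReal_mul (by positivity),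
      ← ENNReal.ofReal_mul hC, Real.mul_rpow hu.le hv.le,
      show 1 - 2 * H = (1 / 2 - H) + (1 / 2 - H) by ring, Real.rpow_add hs]
    ring_nf

lemma lintegral_kernelDensity_mul_kernelDensity {H u v : ℝ} (hH : H ∈ Ioo (1 / 2 : ℝ) 1)
    (hu : 0 < u) (hv : 0 < v) (huv : u ≠ v) :
    ∫⁻ s in Ioi 0, kernelDensity H u s * kernelDensity H v s
      = ENNReal.ofReal (H * (2 * H - 1) * |u - v| ^ (2 * H - 2)) := by
  rcases huv.lt_or_gt with h | h
  · rw [lintegral_kernelDensity_mul_kernelDensity_of_lt hH hu h, abs_sub_comm,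
      abs_of_pos (sub_pos.2 h)]
  · simp_rw [mul_comm (kernelDensity H u _)]
    rw [lintegral_kernelDensity_mul_kernelDensity_of_lt hH hv h, abs_of_pos (sub_pos.2 h)]

lemma lkernel_le_of_lt {H a s : ℝ} (t : ℝ) (has : a < s) :
    lkernel H t s ≤ ∫⁻ u in Ioc a t, kernelDensity H u s := by
  have hsub : Iic t ⊆ Iic a ∪ Ioc a t := fun u hu ↦ (le_or_gt u a).imp id fun h ↦ ⟨h, hu⟩
  refine (lintegral_mono_set hsub).trans ((lintegral_union_le _ _ _).trans_eq ?_)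
  rw [setLIntegral_eq_zero measurableSet_Iic fun u hu ↦ ?_, zero_add]
  simp [kernelDensity, not_lt.2 ((mem_Iic.1 hu).trans has.le)]

/-- The mass of `K_H(t,·)²` to the right of `a` is at most the variance of the increment
of fractional Brownian motion from `a` to `t`. -/
lemma lintegral_lkernel_sq_le {H a t : ℝ} (hH : H ∈ Ioo (1 / 2 : ℝ) 1) (ha : 0 ≤ a)
    (hat : a ≤ t) :
    ∫⁻ s in Ioi a, lkernel H t s ^ 2 ≤ ENNReal.ofReal ((t - a) ^ (2 * H)) := by
  calc ∫⁻ s in Ioi a, lkernel H t s ^ 2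
    _ ≤ ∫⁻ s in Ioi a, ∫⁻ u in Ioc a t, ∫⁻ v in Ioc a t,
          kernelDensity H u s * kernelDensity H v s := by
        refine setLIntegral_mono' measurableSet_Ioi fun s hs ↦ ?_
        have hm : Measurable fun u ↦ kernelDensity H u s :=
          .kernelDensity H measurable_id measurable_const
        rw [lintegral_lintegral_mul hm.aemeasurable hm.aemeasurable, ← sq]
        exact pow_le_pow_left' (lkernel_le_of_lt t hs) 2
    _ = ∫⁻ u in Ioc a t, ∫⁻ s in Ioi a, ∫⁻ v in Ioc a t,
          kernelDensity H u s * kernelDensity H v s := by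
        refine lintegral_lintegral_swap (Measurable.aemeasurable ?_)
        refine Measurable.lintegral_prod_right'
          (f := fun q : (ℝ × ℝ) × ℝ ↦ kernelDensity H q.1.2 q.1.1 * kernelDensity H q.2 q.1.1) ?_
        exact (Measurable.kernelDensity H (by fun_prop) (by fun_prop)).mul
          (.kernelDensity H (by fun_prop) (by fun_prop))
    _ = ∫⁻ u in Ioc a t, ∫⁻ v in Ioc a t, ∫⁻ s in Ioi a,
          kernelDensity H u s * kernelDensity H v s := by
        refine lintegral_congr fun u ↦ lintegral_lintegral_swap (Measurable.aemeasurable ?_)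
        exact (Measurable.kernelDensity H (by fun_prop) (by fun_prop)).mul
          (.kernelDensity H (by fun_prop) (by fun_prop))
    _ ≤ ∫⁻ u in Ioc a t, ∫⁻ v in Ioc a t,
          ENNReal.ofReal (H * (2 * H - 1) * |u - v| ^ (2 * H - 2)) := by
        refine setLIntegral_mono' measurableSet_Ioc fun u hu ↦ ?_
        refine setLIntegral_mono_ae' measurableSet_Ioc ?_
        filter_upwards [Measure.ae_ne volume u] with v hvu hv
        rw [← lintegral_kernelDensity_mul_kernelDensity hH (ha.trans_lt hu.1)
          (ha.trans_lt hv.1) hvu.symm]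
        exact lintegral_mono_set (Ioi_subset_Ioi ha)
    _ ≤ _ := lintegral_lintegral_abs_sub_rpow_le hH hat

lemma lintegral_lintegral_lkernel_sq_le {H a t : ℝ} (hH : H ∈ Ioo (1 / 2 : ℝ) 1) (ha : 0 ≤ a) :
    ∫⁻ θ in Ioc a t, ∫⁻ s in Ioc a t, lkernel H s θ ^ 2
      ≤ ENNReal.ofReal ((t - a) ^ (2 * H)) * ENNReal.ofReal (t - a) := by
  rw [lintegral_lintegral_swap
    (((measurable_lkernel H).comp measurable_swap).pow_const 2).aemeasurable]
  refine (setLIntegral_mono' (g := fun _ ↦ ENNReal.ofReal ((t - a) ^ (2 * H)))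
    measurableSet_Ioc fun s hs ↦ ?_).trans_eq ?_
  · refine (lintegral_mono_set Ioc_subset_Ioi_self).trans
      ((lintegral_lkernel_sq_le hH ha hs.1.le).trans (ENNReal.ofReal_le_ofReal ?_))
    exact Real.rpow_le_rpow (by linarith [hs.1]) (by linarith [hs.2]) (by linarith [hH.1])
  · rw [setLIntegral_const, Real.volume_Ioc]

lemma enorm_intervalIntegral_sq_le {f : ℝ → ℝ} {g : ℝ → ℝ≥0∞} {c d : ℝ} (hcd : c ≤ d)
    (hfg : ∀ s, ‖f s‖ₑ ≤ g s) :
    ‖∫ s in c..d, f s ^ 2‖ₑ ≤ ∫⁻ s in Ioc c d, g s ^ 2 := by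
  rw [intervalIntegral.integral_of_le hcd]
  refine (enorm_integral_le_lintegral_enorm _).trans (lintegral_mono fun s ↦ ?_)
  rw [enorm_pow]
  exact pow_le_pow_left' (hfg s) 2

/-- For `0 ≤ a ≤ t`,
`∫_a^t (∫_θ^t K_H(t,s)² ds)(∫_θ^t K_H(s,θ)² ds) dθ ≤ (t-a)^(4H+1)`. -/
theorem stmt_11 (H : ℝ) (hH : H ∈ Set.Ioo (1/2 : ℝ) 1) (a t : ℝ) (ha : 0 ≤ a) (hat : a ≤ t) :
    ∫ θ in a..t, (∫ s in θ..t, (KH H t s)^2) * (∫ s in θ..t, (KH H s θ)^2)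
      ≤ (t - a) ^ (4*H + 1) := by
  have hta : 0 ≤ t - a := sub_nonneg.2 hat
  have hH2 : 0 ≤ 2 * H := by linarith [hH.1]
  refine (le_abs_self _).trans ((ENNReal.ofReal_le_ofReal_iff (by positivity)).1 ?_)
  rw [← Real.enorm_eq_ofReal_abs, intervalIntegral.integral_of_le hat]
  refine (enorm_integral_le_lintegral_enorm _).trans ?_
  calc ∫⁻ θ in Ioc a t, ‖(∫ s in θ..t, (KH H t s) ^ 2) * (∫ s in θ..t, (KH H s θ) ^ 2)‖ₑ
    _ ≤ ∫⁻ θ in Ioc a t, ENNReal.ofReal ((t - a) ^ (2 * H))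
          * ∫⁻ s in Ioc a t, lkernel H s θ ^ 2 := by
        refine setLIntegral_mono' measurableSet_Ioc fun θ hθ ↦ ?_
        rw [enorm_mul]
        refine mul_le_mul' ?_ ?_
        · refine (enorm_intervalIntegral_sq_le hθ.2 (enorm_KH_le_lkernel H t)).trans
            ((lintegral_mono_set Ioc_subset_Ioi_self).trans
              ((lintegral_lkernel_sq_le hH (ha.trans hθ.1.le) hθ.2).trans
                (ENNReal.ofReal_le_ofReal ?_)))
          exact Real.rpow_le_rpow (by linarith [hθ.2]) (by linarith [hθ.1]) hH2
        · exact (enorm_intervalIntegral_sq_le hθ.2 fun s ↦ enorm_KH_le_lkernel H s θ).trans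
            (lintegral_mono_set (Ioc_subset_Ioc_left hθ.1.le))
    _ ≤ ENNReal.ofReal ((t - a) ^ (2 * H))
          * (ENNReal.ofReal ((t - a) ^ (2 * H)) * ENNReal.ofReal (t - a)) := by
        rw [lintegral_const_mul' _ _ ENNReal.ofReal_ne_top]
        exact mul_le_mul_right (lintegral_lintegral_lkernel_sq_le hH ha) _
    _ = ENNReal.ofReal ((t - a) ^ (4 * H + 1)) := by
        have hpos : 0 ≤ (t - a) ^ (2 * H) := Real.rpow_nonneg hta _
        rw [← ENNReal.ofReal_mul hpos, ← ENNReal.ofReal_mul hpos,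
          show 4 * H + 1 = 2 * H + (2 * H + 1) by ring,
          Real.rpow_add_of_nonneg hta hH2 (by linarith),
          Real.rpow_add_of_nonneg hta hH2 zero_le_one, Real.rpow_one]
end

section
/- Let $T>0$, $M\ge 0$, $\theta\in(0,T)$ and $a\in\mathbb{R}$, and let $\psi:[0,T]\to\mathbb{R}$ be measurable with $|\psi(s)|\le M$ for all $s$. Suppose $f:[\theta,T]\to\mathbb{R}$ is a bounded measurable function satisfying the linear Volterra equation $f(t) = a\,K_H(t,\theta) + \int_\theta^t K_H(t,s)\,\psi(s)\,f(s)\,ds$ for all $t\in[\theta,T]$. Then there exists a constant $C>0$, depending only on $H$, $T$, $M$ and $|a|$ (in particular not on $\theta$), such that $|f(t)| \le C\,K_H(t,\theta)$ for all $t\in[\theta,T]$. -/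
open MeasureTheory Set

/-- Grönwall's inequality in integral form, with a continuous nonnegative weight and an integrable
(not necessarily continuous) function. -/
theorem le_mul_exp_integral_of_le_add_integral {φ w : ℝ → ℝ} {a b A : ℝ} (hab : a ≤ b)
    (hw : ContinuousOn w (Icc a b)) (hw0 : ∀ s ∈ Icc a b, 0 ≤ w s)
    (hφ : IntervalIntegrable φ volume a b)
    (h : ∀ r ∈ Icc a b, φ r ≤ A + ∫ s in a..r, w s * φ s) :
    φ b ≤ A * Real.exp (∫ s in a..b, w s) := by
  have hu : uIcc a b = Icc a b := uIcc_of_le hab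
  have sub_Icc : ∀ {r}, r ∈ Icc a b → uIcc a r ⊆ uIcc a b := fun {r} hr => by
    rw [hu, uIcc_of_le hr.1]; exact Icc_subset_Icc_right hr.2
  have hwφ : IntervalIntegrable (fun s => w s * φ s) volume a b :=
    hφ.continuousOn_mul (hu ▸ hw)
  have hcont : ∀ {g : ℝ → ℝ}, IntervalIntegrable g volume a b →
      ContinuousOn (fun r => ∫ s in a..r, g s) (Icc a b) := fun {g} hg => by
    have := intervalIntegral.continuousOn_primitive_interval'
      (b₁ := a) (b₂ := b) (a := a) hg left_mem_uIcc
    rwa [hu] at this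
  set F : ℝ → ℝ := fun r => A + ∫ s in a..r, w s * φ s with hF
  have hFc : ContinuousOn F (Icc a b) := continuousOn_const.add (hcont hwφ)
  have hwFc : ContinuousOn (fun s => w s * F s) (Icc a b) := hw.mul hFc
  have hwF : IntervalIntegrable (fun s => w s * F s) volume a b :=
    (hu ▸ hwFc : ContinuousOn _ (uIcc a b)).intervalIntegrable
  have hwi : IntervalIntegrable w volume a b :=
    (hu ▸ hw : ContinuousOn _ (uIcc a b)).intervalIntegrable
  set E : ℝ → ℝ := fun r => A + ∫ s in a..r, w s * F s with hE
  have hFE : ∀ r ∈ Icc a b, F r ≤ E r := fun r hr => by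
    have := intervalIntegral.integral_mono_on hr.1 (hwφ.mono_set (sub_Icc hr))
      (hwF.mono_set (sub_Icc hr)) (fun s hs => by
        have hs' : s ∈ Icc a b := ⟨hs.1, hs.2.trans hr.2⟩
        exact mul_le_mul_of_nonneg_left (h s hs') (hw0 s hs'))
    simp only [hF, hE] at this ⊢
    linarith
  have hderiv : ∀ {g : ℝ → ℝ}, ContinuousOn g (Icc a b) → ∀ r ∈ Ioo a b,
      HasDerivAt (fun r => ∫ s in a..r, g s) (g r) r := fun {g} hg r hr => by
    have hn : Icc a b ∈ nhds r := Icc_mem_nhds hr.1 hr.2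
    refine intervalIntegral.integral_hasDerivAt_right ?_ ?_ (hg.continuousAt hn)
    · exact ((hu ▸ hg : ContinuousOn _ (uIcc a b)).mono
        (sub_Icc ⟨hr.1.le, hr.2.le⟩)).intervalIntegrable
    · exact (hg.mono Ioo_subset_Icc_self).stronglyMeasurableAtFilter isOpen_Ioo r hr
  have hQ : AntitoneOn (fun r => E r * Real.exp (-∫ s in a..r, w s)) (Icc a b) := by
    have hD : ∀ r ∈ Ioo a b, HasDerivAt (fun r => E r * Real.exp (-∫ s in a..r, w s))
        (w r * F r * Real.exp (-∫ s in a..r, w s) +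
          E r * (Real.exp (-∫ s in a..r, w s) * -w r)) r := fun r hr =>
      ((hderiv hwFc r hr).const_add A).mul (hderiv hw r hr).neg.exp
    refine antitoneOn_of_deriv_nonpos (convex_Icc a b) ?_ ?_ ?_
    · exact (continuousOn_const.add (hcont hwF)).mul (hcont hwi).neg.rexp
    · rw [interior_Icc]
      exact fun r hr => (hD r hr).differentiableAt.differentiableWithinAt
    · rw [interior_Icc]
      intro r hr
      rw [(hD r hr).deriv]
      have hr' := Ioo_subset_Icc_self hr
      have := mul_nonneg (mul_nonneg (hw0 r hr') (sub_nonneg.2 (hFE r hr')))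
        (Real.exp_pos (-∫ s in a..r, w s)).le
      linarith
  have hQab := hQ (left_mem_Icc.2 hab) (right_mem_Icc.2 hab) hab
  have hEa : E a = A := by simp [hE]
  simp only [hEa, intervalIntegral.integral_same, neg_zero, Real.exp_zero, mul_one,
    Real.exp_neg] at hQab
  rw [← div_eq_mul_inv, div_le_iff₀ (Real.exp_pos _)] at hQab
  have hb := right_mem_Icc.2 hab
  exact (h b hb).trans ((hFE b hb).trans hQab)

theorem cH_nonneg (H : ℝ) : 0 ≤ cH H := Real.sqrt_nonneg _

theorem intervalIntegrable_sub_rpow {p : ℝ} (hp : -1 < p) (s t : ℝ) :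
    IntervalIntegrable (fun u : ℝ => (u - s) ^ p) volume s t := by
  simpa using (intervalIntegral.intervalIntegrable_rpow' (a := 0) (b := t - s) hp).comp_sub_right s

theorem intervalIntegrable_KH_integrand {H : ℝ} (hH : 1 / 2 < H) (s t : ℝ) :
    IntervalIntegrable (fun u : ℝ => (u - s) ^ (H - 3 / 2) * u ^ (H - 1 / 2)) volume s t :=
  (intervalIntegrable_sub_rpow (by linarith) s t).mul_continuousOn
    (Real.continuous_rpow_const (by linarith)).continuousOn

theorem KH_integrand_nonneg {H s u : ℝ} (hs : 0 ≤ s) (hu : s ≤ u) :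
    0 ≤ (u - s) ^ (H - 3 / 2) * u ^ (H - 1 / 2) :=
  mul_nonneg (Real.rpow_nonneg (sub_nonneg.2 hu) _) (Real.rpow_nonneg (hs.trans hu) _)

theorem KH_nonneg (H t s : ℝ) : 0 ≤ KH H t s := by
  unfold KH
  split_ifs with h
  · exact mul_nonneg (mul_nonneg (cH_nonneg H) (Real.rpow_nonneg h.1.le _))
      (intervalIntegral.integral_nonneg h.2.le fun u hu => KH_integrand_nonneg h.1.le hu.1)
  · exact le_rfl

theorem monotone_KH {H : ℝ} (hH : 1 / 2 < H) (s : ℝ) : Monotone fun t => KH H t s := by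
  intro t₁ t₂ h
  by_cases h₁ : 0 < s ∧ s < t₁
  · have h₂ : 0 < s ∧ s < t₂ := ⟨h₁.1, h₁.2.trans_le h⟩
    simp only [KH, if_pos h₁, if_pos h₂]
    refine mul_le_mul_of_nonneg_left ?_ (mul_nonneg (cH_nonneg H) (Real.rpow_nonneg h₁.1.le _))
    refine intervalIntegral.integral_mono_interval le_rfl h₁.2.le h ?_
      (intervalIntegrable_KH_integrand hH s t₂)
    filter_upwards [ae_restrict_mem measurableSet_Ioc] with u hu
    exact KH_integrand_nonneg h₁.1.le hu.1.le
  · refine le_trans (le_of_eq ?_) (KH_nonneg H t₂ s)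
    simp only [KH, if_neg h₁]

theorem KH_le_mul_rpow {H : ℝ} (hH : 1 / 2 < H) {s t T : ℝ} (hs : 0 < s) (ht : t ≤ T) :
    KH H t s ≤ cH H * (T ^ (H - 1 / 2) / (H - 1 / 2) * T ^ (H - 1 / 2)) *
      s ^ ((1 : ℝ) / 2 - H) := by
  have hα : 0 < H - 1 / 2 := by linarith
  by_cases h : s < t
  · have hst : 0 ≤ t - s := sub_nonneg.2 h.le
    have hint : ∫ u in s..t, (u - s) ^ (H - 3 / 2) * u ^ (H - 1 / 2) ≤
        T ^ (H - 1 / 2) / (H - 1 / 2) * T ^ (H - 1 / 2) := calc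
      _ ≤ ∫ u in s..t, (u - s) ^ (H - 3 / 2) * T ^ (H - 1 / 2) := by
        refine intervalIntegral.integral_mono_on h.le (intervalIntegrable_KH_integrand hH s t)
          ((intervalIntegrable_sub_rpow (by linarith) s t).mul_const _) fun u hu => ?_
        exact mul_le_mul_of_nonneg_left
          (Real.rpow_le_rpow (hs.le.trans hu.1) (hu.2.trans ht) hα.le)
          (Real.rpow_nonneg (sub_nonneg.2 hu.1) _)
      _ = (t - s) ^ (H - 1 / 2) / (H - 1 / 2) * T ^ (H - 1 / 2) := by
        rw [intervalIntegral.integral_mul_const,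
          intervalIntegral.integral_comp_sub_right (fun u : ℝ => u ^ (H - 3 / 2)) s, sub_self,
          integral_rpow (Or.inl (by linarith)),
          show H - 3 / 2 + 1 = H - 1 / 2 by ring, Real.zero_rpow hα.ne', sub_zero]
      _ ≤ _ := by
        refine mul_le_mul_of_nonneg_right ?_ (Real.rpow_nonneg (by linarith) _)
        exact div_le_div_of_nonneg_right (Real.rpow_le_rpow hst (by linarith) hα.le) hα.le
    rw [KH, if_pos ⟨hs, h⟩, mul_right_comm]
    exact mul_le_mul_of_nonneg_right (mul_le_mul_of_nonneg_left hint (cH_nonneg H))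
      (Real.rpow_nonneg hs.le _)
  · rw [KH, if_neg (fun h' => h h'.2)]
    have h0 : 0 ≤ T ^ (H - 1 / 2) * T ^ (H - 1 / 2) := mul_self_nonneg _
    rw [div_mul_eq_mul_div]
    exact mul_nonneg (mul_nonneg (cH_nonneg H) (div_nonneg h0 hα.le)) (Real.rpow_nonneg hs.le _)

/-- Pointwise bound for bounded solutions of the linear Volterra equation
`f(t) = a K_H(t,θ) + ∫_θ^t K_H(t,s) ψ(s) f(s) ds` on `[θ,T]`: there is a constant
`C = C(H,T,M,|a|) > 0` (not depending on `θ`) with `|f(t)| ≤ C K_H(t,θ)` on `[θ,T]`. -/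
theorem stmt_12 (H : ℝ) (hH : H ∈ Set.Ioo (1/2 : ℝ) 1) (T M : ℝ) (hT : 0 < T) (hM : 0 ≤ M)
    (a : ℝ) :
    ∃ C > 0, ∀ θ ∈ Set.Ioo (0:ℝ) T,
      ∀ ψ : ℝ → ℝ, Measurable ψ → (∀ s ∈ Set.Icc (0:ℝ) T, |ψ s| ≤ M) →
      ∀ f : ℝ → ℝ, Measurable f → (∃ Mf, ∀ t ∈ Set.Icc θ T, |f t| ≤ Mf) →
      (∀ t ∈ Set.Icc θ T, f t = a * KH H t θ + ∫ s in θ..t, KH H t s * ψ s * f s) →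
      ∀ t ∈ Set.Icc θ T, |f t| ≤ C * KH H t θ := by
  obtain ⟨hH1, hH2⟩ := hH
  have hα : 0 < H - 1 / 2 := by linarith
  set D := cH H * (T ^ (H - 1 / 2) / (H - 1 / 2) * T ^ (H - 1 / 2))
  have hD0 : 0 ≤ D := by
    have := cH_nonneg H
    positivity
  set w : ℝ → ℝ := fun s => D * s ^ ((1 : ℝ) / 2 - H) * M
  have hw0 : ∀ s, 0 ≤ s → 0 ≤ w s := fun s hs =>
    mul_nonneg (mul_nonneg hD0 (Real.rpow_nonneg hs _)) hM
  have hwi : IntervalIntegrable w volume 0 T :=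
    ((intervalIntegral.intervalIntegrable_rpow' (by linarith)).const_mul D).mul_const M
  refine ⟨(|a| + 1) * Real.exp (∫ s in (0 : ℝ)..T, w s), by positivity, ?_⟩
  rintro θ ⟨hθ, -⟩ ψ - hψ f hf ⟨Mf, hMf⟩ heq t ⟨hθt, htT⟩
  have hwc : ContinuousOn w (Icc θ t) :=
    ((continuousOn_id.rpow_const fun s hs => Or.inl (hθ.trans_le hs.1).ne').const_mul
      D).mul_const M
  have hfi : IntervalIntegrable (fun s => |f s|) volume θ t := by
    refine (intervalIntegrable_const (c := Mf)).mono_fun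
      hf.abs.aestronglyMeasurable ?_
    filter_upwards [ae_restrict_mem measurableSet_uIoc] with s hs
    rw [uIoc_of_le hθt] at hs
    rw [Real.norm_eq_abs, abs_abs]
    exact (hMf s ⟨hs.1.le, hs.2.trans htT⟩).trans (le_abs_self Mf)
  have hwf : IntervalIntegrable (fun s => w s * |f s|) volume θ t :=
    hfi.continuousOn_mul (uIcc_of_le hθt ▸ hwc)
  have hineq : ∀ r ∈ Icc θ t, |f r| ≤ |a| * KH H t θ + ∫ s in θ..r, w s * |f s| := by
    intro r hr
    have hrT := hr.2.trans htT
    rw [heq r ⟨hr.1, hrT⟩]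
    refine (abs_add_le _ _).trans (add_le_add ?_ ?_)
    · rw [abs_mul, abs_of_nonneg (KH_nonneg H r θ)]
      exact mul_le_mul_of_nonneg_left (monotone_KH hH1 θ hr.2) (abs_nonneg a)
    · rw [← Real.norm_eq_abs]
      refine intervalIntegral.norm_integral_le_of_norm_le hr.1 (ae_of_all _ fun s hs => ?_)
        (hwf.mono_set ?_)
      · have hs0 : 0 < s := hθ.trans hs.1
        rw [Real.norm_eq_abs, abs_mul, abs_mul, abs_of_nonneg (KH_nonneg H r s)]
        exact mul_le_mul_of_nonneg_right (mul_le_mul (KH_le_mul_rpow hH1 hs0 hrT)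
          (hψ s ⟨hs0.le, hs.2.trans hrT⟩) (abs_nonneg _)
          (mul_nonneg hD0 (Real.rpow_nonneg hs0.le _))) (abs_nonneg _)
      · rw [uIcc_of_le hr.1, uIcc_of_le hθt]
        exact Icc_subset_Icc_right hr.2
  have hle : ∫ s in θ..t, w s ≤ ∫ s in (0 : ℝ)..T, w s := by
    refine intervalIntegral.integral_mono_interval hθ.le hθt htT ?_ hwi
    filter_upwards [ae_restrict_mem measurableSet_Ioc] with s hs
    exact hw0 s hs.1.le
  calc |f t| ≤ |a| * KH H t θ * Real.exp (∫ s in θ..t, w s) :=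
        le_mul_exp_integral_of_le_add_integral hθt hwc (fun s hs => hw0 s (hθ.le.trans hs.1))
          hfi hineq
    _ ≤ (|a| + 1) * KH H t θ * Real.exp (∫ s in (0 : ℝ)..T, w s) := by
        have := KH_nonneg H t θ
        gcongr
        linarith
    _ = _ := by ring
end
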